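/- Let p : ({-1,1}^n)^d → ℝ be a homogeneous block-multilinear polynomial of degree d and let s ∈ [d]. Then the completely bounded norm of p satisfies the root-influence inequality ‖p‖_cb ≥ Σ_{i∈[n]} √(Inf_{s,i}[p]). -/

import Mathlib

noncomputable section

/-- `E m` is the Euclidean space `ℝ^m`. -/
abbrev E (m : ℕ) := EuclideanSpace ℝ (Fin m)

/-- A block-multilinear polynomial `p : ({-1,1}^n)^d → ℝ` is encoded by its Fourier
coefficients `g : (Fin d → Option (Fin n)) → ℝ`: a set `S` of pairs `(block, coordinate)`
containing at most one pair from each block corresponds to the function `σ` with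
`σ b = some i` iff `(b,i) ∈ S`.  `blockSize σ` is the cardinality `|S|`. -/
def blockSize {n d : ℕ} (σ : Fin d → Option (Fin n)) : ℕ :=
  (Finset.univ.filter fun b => (σ b).isSome).card

/-- The evaluation `p(A_1,…,A_d)` of a block-multilinear polynomial on `n`-tuples of
operators: `Σ_S p̂(S) A_{b_1}(i_1)⋯A_{b_s}(i_s)` (with identity in the blocks not
occurring in `S`, giving the ordered product over blocks `b_1 < ⋯ < b_s`). -/
def blockEval {n d m : ℕ} (g : (Fin d → Option (Fin n)) → ℝ)
    (A : Fin d → Fin n → (E m →L[ℝ] E m)) : E m →L[ℝ] E m :=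
  ∑ σ : Fin d → Option (Fin n),
    g σ • (List.ofFn fun b => Option.elim (σ b) 1 fun i => A b i).prod

/-- The completely bounded norm `‖p‖_cb`: the supremum of `‖p(A_1,…,A_d)‖_op` over all
`m` and all tuples of operators of norm at most 1. -/
def cbNorm {n d : ℕ} (g : (Fin d → Option (Fin n)) → ℝ) : ℝ :=
  sSup { r | ∃ (m : ℕ) (A : Fin d → Fin n → (E m →L[ℝ] E m)),
    (∀ b i, ‖A b i‖ ≤ 1) ∧ r = ‖blockEval g A‖ }

/-- The influence of variable `(b,i)`: `Inf_{b,i}[p] = Σ_{S ∋ (b,i)} p̂(S)²`. -/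
def inflB {n d : ℕ} (g : (Fin d → Option (Fin n)) → ℝ) (b : Fin d) (i : Fin n) : ℝ :=
  ∑ σ ∈ Finset.univ.filter (fun σ : Fin d → Option (Fin n) => σ b = some i), g σ ^ 2

/-- The variance `Var[p] = Σ_{S ≠ ∅} p̂(S)²`. -/
def varB {n d : ℕ} (g : (Fin d → Option (Fin n)) → ℝ) : ℝ :=
  ∑ σ ∈ Finset.univ.filter
      (fun σ : Fin d → Option (Fin n) => σ ≠ fun _ => none), g σ ^ 2

/-- Partial assignments of coordinates to blocks, used as indices of basis vectors. -/
abbrev Assignment (n d : ℕ) := Fin d → Option (Fin n)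

/-- The operator `x ↦ (τ ↦ x (h τ) if τ ∈ S, else 0)`. -/
def partialComp {ι : Type*} [Fintype ι] [DecidableEq ι] (S : Finset ι) (h : ι → ι) :
    EuclideanSpace ℝ ι →L[ℝ] EuclideanSpace ℝ ι :=
  LinearMap.toContinuousLinearMap
    { toFun := fun x => WithLp.toLp 2 fun τ => if τ ∈ S then x (h τ) else 0
      map_add' := fun x y => by ext τ; simp only [PiLp.add_apply]; split_ifs <;> simp
      map_smul' := fun c x => by ext τ; simp }

theorem partialComp_apply {ι : Type*} [Fintype ι] [DecidableEq ι] (S : Finset ι) (h : ι → ι)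
    (x : EuclideanSpace ℝ ι) (τ : ι) :
    partialComp S h x τ = if τ ∈ S then x (h τ) else 0 := rfl

theorem norm_partialComp_le {ι : Type*} [Fintype ι] [DecidableEq ι] (S : Finset ι) (h : ι → ι)
    (hinj : Set.InjOn h S) : ‖partialComp S h‖ ≤ 1 := by
  refine ContinuousLinearMap.opNorm_le_bound _ zero_le_one fun x => ?_
  rw [one_mul]
  refine le_of_sq_le_sq ?_ (norm_nonneg _)
  rw [EuclideanSpace.real_norm_sq_eq, EuclideanSpace.real_norm_sq_eq]
  calc ∑ τ, partialComp S h x τ ^ 2 = ∑ τ ∈ S, x (h τ) ^ 2 := by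
        simp [partialComp_apply, ite_pow]
    _ = ∑ ρ ∈ S.image h, x ρ ^ 2 := (Finset.sum_image (f := fun ρ => x ρ ^ 2) hinj).symm
    _ ≤ ∑ ρ, x ρ ^ 2 :=
        Finset.sum_le_sum_of_subset_of_nonneg (Finset.subset_univ _) fun _ _ _ => sq_nonneg _

/-- The operator with matrix `M` in the standard basis. -/
def matrixOp {ι : Type*} [Fintype ι] (M : ι → ι → ℝ) :
    EuclideanSpace ℝ ι →L[ℝ] EuclideanSpace ℝ ι :=
  LinearMap.toContinuousLinearMap
    { toFun := fun x => WithLp.toLp 2 fun τ => ∑ ρ, M τ ρ * x ρ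
      map_add' := fun x y => by ext τ; simp [mul_add, Finset.sum_add_distrib]
      map_smul' := fun c x => by ext τ; simp [Finset.mul_sum, mul_left_comm] }

theorem matrixOp_apply {ι : Type*} [Fintype ι] (M : ι → ι → ℝ) (x : EuclideanSpace ℝ ι) (τ : ι) :
    matrixOp M x τ = ∑ ρ, M τ ρ * x ρ := rfl

theorem norm_matrixOp_le {ι : Type*} [Fintype ι] (M : ι → ι → ℝ)
    (hM : ∑ τ, ∑ ρ, M τ ρ ^ 2 ≤ 1) : ‖matrixOp M‖ ≤ 1 := by
  refine ContinuousLinearMap.opNorm_le_bound _ zero_le_one fun x => ?_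
  rw [one_mul]
  refine le_of_sq_le_sq ?_ (norm_nonneg _)
  rw [EuclideanSpace.real_norm_sq_eq, EuclideanSpace.real_norm_sq_eq]
  calc ∑ τ, matrixOp M x τ ^ 2 ≤ ∑ τ, (∑ ρ, M τ ρ ^ 2) * ∑ ρ, x ρ ^ 2 :=
        Finset.sum_le_sum fun τ _ => by
          rw [matrixOp_apply]; exact Finset.sum_mul_sq_le_sq_mul_sq _ _ _
    _ = (∑ τ, ∑ ρ, M τ ρ ^ 2) * ∑ ρ, x ρ ^ 2 := by rw [Finset.sum_mul]
    _ ≤ ∑ ρ, x ρ ^ 2 :=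
        mul_le_of_le_one_left (Finset.sum_nonneg fun _ _ => sq_nonneg _) hM

theorem norm_list_prod_le_one {V : Type*} [NormedAddCommGroup V] [NormedSpace ℝ V]
    (l : List (V →L[ℝ] V)) (hl : ∀ a ∈ l, ‖a‖ ≤ 1) :
    ‖l.prod‖ ≤ 1 := by
  induction l with
  | nil => exact ContinuousLinearMap.norm_id_le
  | cons a l ih =>
    rw [List.prod_cons]
    have hp : ‖l.prod‖ ≤ 1 := ih fun b hb => hl b (List.mem_cons_of_mem a hb)
    have ha : ‖a‖ ≤ 1 := hl a List.mem_cons_self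
    have hmul : ‖a * l.prod‖ ≤ ‖a‖ * ‖l.prod‖ := ContinuousLinearMap.opNorm_comp_le a l.prod
    exact hmul.trans (mul_le_one₀ ha (norm_nonneg _) hp)

theorem norm_blockEval_le {n d m : ℕ} (g : Assignment n d → ℝ)
    (A : Fin d → Fin n → (E m →L[ℝ] E m)) (hA : ∀ b i, ‖A b i‖ ≤ 1) :
    ‖blockEval g A‖ ≤ ∑ σ, |g σ| := by
  refine norm_sum_le_of_le _ fun σ _ => ?_
  rw [norm_smul, Real.norm_eq_abs]
  refine mul_le_of_le_one_right (abs_nonneg _) (norm_list_prod_le_one _ fun a ha => ?_)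
  obtain ⟨b, hb⟩ := (List.mem_ofFn' _ _).1 ha
  rw [← hb]
  beta_reduce
  rcases σ b with _ | i
  · exact ContinuousLinearMap.norm_id_le (𝕜 := ℝ) (E := E m)
  · exact hA b i

theorem norm_blockEval_le_cbNorm {n d m : ℕ} (g : Assignment n d → ℝ)
    (A : Fin d → Fin n → (E m →L[ℝ] E m)) (hA : ∀ b i, ‖A b i‖ ≤ 1) :
    ‖blockEval g A‖ ≤ cbNorm g := by
  refine le_csSup ⟨∑ σ, |g σ|, ?_⟩ ⟨m, A, hA, rfl⟩
  rintro _ ⟨m, A, hA, rfl⟩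
  exact norm_blockEval_le g A hA

/-- The quadratic form of `p(A_1,…,A_d)` at a basis vector bounds `‖p‖_cb` from below, for operators
on a Euclidean space with an arbitrary finite index type. -/
theorem sum_matrixCoeff_le_cbNorm {n d : ℕ} {ι : Type*} [Fintype ι] [DecidableEq ι]
    (g : Assignment n d → ℝ)
    (A : Fin d → Fin n → (EuclideanSpace ℝ ι →L[ℝ] EuclideanSpace ℝ ι))
    (hA : ∀ b i, ‖A b i‖ ≤ 1) (o : ι) :
    ∑ σ, g σ * (List.ofFn fun b => Option.elim (σ b) 1 fun i => A b i).prod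
      (EuclideanSpace.single o 1) o ≤ cbNorm g := by
  let F : EuclideanSpace ℝ ι ≃ₗᵢ[ℝ] E (Fintype.card ι) :=
    LinearIsometryEquiv.piLpCongrLeft 2 ℝ ℝ (Fintype.equivFin ι)
  let C := F.toContinuousLinearEquiv.conjContinuousAlgEquiv
  have hC : ∀ T x, C T x = F (T (F.symm x)) := fun T x => rfl
  have hCA : ∀ b i, ‖C (A b i)‖ ≤ 1 := fun b i => by
    refine ContinuousLinearMap.opNorm_le_bound _ zero_le_one fun x => ?_
    rw [hC, F.norm_map]
    simpa using (A b i).le_of_opNorm_le (hA b i) (F.symm x)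
  refine le_trans ?_ (norm_blockEval_le_cbNorm g (fun b i => C (A b i)) hCA)
  have key : blockEval g (fun b i => C (A b i)) (F (EuclideanSpace.single o 1)) =
      F (∑ σ, g σ • (List.ofFn fun b => Option.elim (σ b) 1 fun i => A b i).prod
        (EuclideanSpace.single o 1)) := by
    rw [blockEval, sum_apply, map_sum]
    refine Finset.sum_congr rfl fun σ _ => ?_
    have : (List.ofFn fun b => Option.elim (σ b) 1 fun i => C (A b i)) =
        (List.ofFn fun b => Option.elim (σ b) 1 fun i => A b i).map C := by
      rw [List.map_ofFn]
      congr 1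
      ext1 b
      cases h : σ b <;> simp [h]
    rw [this, ← map_list_prod, smul_apply, hC, map_smul,
      LinearIsometryEquiv.symm_apply_apply]
  have h1 := (blockEval g (fun b i => C (A b i))).le_opNorm (F (EuclideanSpace.single o 1))
  rw [key, F.norm_map, F.norm_map, PiLp.norm_single, norm_one, mul_one] at h1
  refine le_trans ?_ h1
  refine le_trans (le_of_eq ?_) ((Real.le_norm_self _).trans
    (PiLp.norm_apply_le (p := 2) (β := fun _ : ι => ℝ) _ o))
  simp

/-- The restriction of an assignment to the blocks before `b`. -/
def restrictBefore {n d : ℕ} (b : ℕ) (σ : Assignment n d) : Assignment n d :=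
  fun c => if c.val < b then σ c else none

/-- The restriction of an assignment to the blocks from `b` on. -/
def restrictFrom {n d : ℕ} (b : ℕ) (σ : Assignment n d) : Assignment n d :=
  fun c => if b ≤ c.val then σ c else none

/-- The assignment agreeing with `τ` before `s`, with `ρ` after `s`, and sending `s` to `k`. -/
def glue {n d : ℕ} (s : Fin d) (k : Fin n) (τ ρ : Assignment n d) : Assignment n d :=
  fun c => if c < s then τ c else if c = s then some k else ρ c

/-- The coefficients of `p` with block `s` fixed to `k`, as a normalised matrix with rows indexed by
assignments of the blocks before `s` and columns by assignments of the blocks after `s`. -/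
def coeffMatrix {n d : ℕ} (g : Assignment n d → ℝ) (s : Fin d) (k : Fin n)
    (τ ρ : Assignment n d) : ℝ :=
  if (∀ c, s ≤ c → τ c = none) ∧ (∀ c, c ≤ s → ρ c = none) then
    g (glue s k τ ρ) / √(inflB g s k) else 0

theorem inflB_nonneg {n d : ℕ} (g : Assignment n d → ℝ) (s : Fin d) (k : Fin n) :
    0 ≤ inflB g s k :=
  Finset.sum_nonneg fun _ _ => sq_nonneg _

theorem sum_coeffMatrix_sq_le {n d : ℕ} (g : Assignment n d → ℝ) (s : Fin d) (k : Fin n) :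
    ∑ τ, ∑ ρ, coeffMatrix g s k τ ρ ^ 2 ≤ 1 := by
  set P : Finset (Assignment n d × Assignment n d) :=
    Finset.univ.filter fun q => (∀ c, s ≤ c → q.1 c = none) ∧ (∀ c, c ≤ s → q.2 c = none)
  have hinj : Set.InjOn (fun q : Assignment n d × Assignment n d => glue s k q.1 q.2) P := by
    rintro ⟨τ, ρ⟩ h ⟨τ', ρ'⟩ h' heq
    simp only [P, Finset.coe_filter, Finset.mem_univ, true_and, Set.mem_ofPred_eq] at h h'
    have hc : ∀ c, glue s k τ ρ c = glue s k τ' ρ' c := congrFun heq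
    simp only [glue] at hc
    refine Prod.ext (funext fun c => ?_) (funext fun c => ?_) <;> have := hc c
    · by_cases hs : c < s
      · simpa [hs] using this
      · simp [h.1 c (not_lt.1 hs), h'.1 c (not_lt.1 hs)]
    · by_cases hs : c ≤ s
      · simp [h.2 c hs, h'.2 c hs]
      · simpa [(not_le.1 hs).not_gt, (not_le.1 hs).ne'] using this
  calc ∑ τ, ∑ ρ, coeffMatrix g s k τ ρ ^ 2
      = ∑ q ∈ P, g (glue s k q.1 q.2) ^ 2 / inflB g s k := by
        rw [← Fintype.sum_prod_type', Finset.sum_filter]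
        refine Finset.sum_congr rfl fun q _ => ?_
        rw [coeffMatrix, ite_pow, div_pow, Real.sq_sqrt (inflB_nonneg g s k)]
        simp
    _ = (∑ σ ∈ P.image fun q => glue s k q.1 q.2, g σ ^ 2) / inflB g s k := by
        rw [Finset.sum_image hinj, Finset.sum_div]
    _ ≤ inflB g s k / inflB g s k := by
        refine div_le_div_of_nonneg_right ?_ (inflB_nonneg g s k)
        refine Finset.sum_le_sum_of_subset_of_nonneg ?_ fun _ _ _ => sq_nonneg _
        intro σ hσ
        obtain ⟨q, -, rfl⟩ := Finset.mem_image.1 hσ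
        simp [glue]
    _ ≤ 1 := div_self_le_one _

/-- Operators extremal for the root-influence inequality at block `s`: blocks before `s` erase a
coordinate, blocks after `s` record one, and block `s` acts by the normalised coefficients. -/
def influenceOp {n d : ℕ} (g : Assignment n d → ℝ) (s b : Fin d) (i : Fin n) :
    EuclideanSpace ℝ (Assignment n d) →L[ℝ] EuclideanSpace ℝ (Assignment n d) :=
  if b < s then
    partialComp (Finset.univ.filter fun τ => τ b = none) fun τ => Function.update τ b (some i)
  else if b = s then matrixOp (coeffMatrix g s i)
  else partialComp (Finset.univ.filter fun τ => τ b = some i) fun τ => Function.update τ b none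

theorem injOn_update_of_apply_eq {α β : Type*} [DecidableEq α] (b : α) (u v : β)
    (S : Set (α → β)) (hS : ∀ τ ∈ S, τ b = u) : Set.InjOn (fun τ => Function.update τ b v) S := by
  intro τ hτ τ' hτ' heq
  have := congrArg (fun f => Function.update f b u) heq
  simp only [Function.update_idem] at this
  rwa [← hS τ hτ, Function.update_eq_self, hS τ hτ, ← hS τ' hτ', Function.update_eq_self] at this

theorem norm_influenceOp_le {n d : ℕ} (g : Assignment n d → ℝ) (s b : Fin d) (i : Fin n) :
    ‖influenceOp g s b i‖ ≤ 1 := by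
  unfold influenceOp
  split_ifs
  · exact norm_partialComp_le _ _ (injOn_update_of_apply_eq b none _ _ (by simp))
  · exact norm_matrixOp_le _ (sum_coeffMatrix_sq_le g s i)
  · exact norm_partialComp_le _ _ (injOn_update_of_apply_eq b (some i) _ _ (by simp))

theorem influenceOp_apply_of_gt {n d : ℕ} (g : Assignment n d → ℝ) {s b : Fin d} (h : s < b)
    {i : Fin n} {σ : Assignment n d} (hσ : σ b = some i) :
    influenceOp g s b i (EuclideanSpace.single (restrictFrom (b + 1) σ) 1) =
      EuclideanSpace.single (restrictFrom b σ) 1 := by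
  ext τ
  rw [influenceOp, if_neg h.not_gt, if_neg h.ne', partialComp_apply]
  have : (τ b = some i ∧ Function.update τ b none = restrictFrom (b + 1) σ) ↔
      τ = restrictFrom b σ := by
    constructor
    · rintro ⟨h1, h2⟩
      ext1 c
      have h3 := congrFun h2 c
      by_cases hc : c = b
      · subst hc; simp [restrictFrom, h1, hσ]
      · have hc' : c.val ≠ b.val := fun h => hc (Fin.ext h)
        have : (b.val + 1 ≤ c.val) ↔ b.val ≤ c.val := by omega
        simpa [restrictFrom, Function.update_of_ne hc, this] using h3
    · rintro rfl
      refine ⟨by simp [restrictFrom, hσ], ?_⟩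
      ext1 c
      by_cases hc : c = b
      · subst hc; simp [restrictFrom]
      · have hc' : c.val ≠ b.val := fun h => hc (Fin.ext h)
        have : (b.val + 1 ≤ c.val) ↔ b.val ≤ c.val := by omega
        simp [restrictFrom, Function.update_of_ne hc, this]
  simp only [Finset.mem_filter, Finset.mem_univ, true_and, PiLp.single_apply, ← ite_and,
    this]

theorem influenceOp_apply_of_lt {n d : ℕ} (g : Assignment n d → ℝ) {s b : Fin d} (h : b < s)
    {i : Fin n} {σ : Assignment n d} (hσ : σ b = some i)
    (x : EuclideanSpace ℝ (Assignment n d)) :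
    influenceOp g s b i x (restrictBefore b σ) = x (restrictBefore (b + 1) σ) := by
  rw [influenceOp, if_pos h, partialComp_apply, if_pos (by simp [restrictBefore])]
  refine congrArg x.ofLp (funext fun c => ?_)
  by_cases hc : c = b
  · subst hc; simp [restrictBefore, hσ]
  · have hc' : c.val ≠ b.val := fun h => hc (Fin.ext h)
    have : (c.val < b.val + 1) ↔ c.val < b.val := by omega
    simp [restrictBefore, Function.update_of_ne hc, this]

theorem influenceOp_apply_self {n d : ℕ} (g : Assignment n d → ℝ) (s : Fin d)
    {i : Fin n} {σ : Assignment n d} (hσ : σ s = some i) :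
    influenceOp g s s i (EuclideanSpace.single (restrictFrom (s + 1) σ) 1) (restrictBefore s σ) =
      g σ / √(inflB g s i) := by
  rw [influenceOp, if_neg (lt_irrefl s), if_pos rfl, matrixOp_apply]
  simp only [PiLp.single_apply, mul_ite, mul_one, mul_zero, Finset.sum_ite_eq',
    Finset.mem_univ, if_true]
  have hg : glue s i (restrictBefore s σ) (restrictFrom (s + 1) σ) = σ := by
    ext1 c
    rcases lt_trichotomy c s with h | rfl | h
    · simp [glue, restrictBefore, h]
    · simp [glue, hσ]
    · have h' : s.val + 1 ≤ c.val := h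
      simp [glue, restrictFrom, h.not_gt, h.ne', h']
  rw [coeffMatrix, if_pos, hg]
  refine ⟨fun c hc => ?_, fun c hc => ?_⟩
  · simp [restrictBefore, hc]
  · have h' : ¬ s.val + 1 ≤ c.val := by have : c.val ≤ s.val := hc; omega
    simp [restrictFrom, h']

theorem prod_drop_ofFn {M : Type*} [Monoid M] {d : ℕ} (f : Fin d → M) (b : Fin d) :
    ((List.ofFn f).drop b).prod = f b * ((List.ofFn f).drop (b + 1)).prod := by
  rw [List.drop_eq_getElem_cons (by simp), List.prod_cons, List.getElem_ofFn]

/-- The matrix coefficient at the empty assignment of a monomial in the operators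
`influenceOp g s`. -/
theorem influenceOp_prod_apply {n d : ℕ} (g : Assignment n d → ℝ) (s : Fin d)
    {σ : Assignment n d} (i : Fin d → Fin n) (hσ : ∀ b, σ b = some (i b)) :
    (List.ofFn fun b => Option.elim (σ b) 1 fun i => influenceOp g s b i).prod
      (EuclideanSpace.single (fun _ => none) 1) (fun _ => none) =
        g σ / √(inflB g s (i s)) := by
  simp only [hσ, Option.elim_some]
  set l := List.ofFn fun b => influenceOp g s b (i b)
  set o : EuclideanSpace ℝ (Assignment n d) := EuclideanSpace.single (fun _ => none) 1
  have step : ∀ b : Fin d, (l.drop b).prod o =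
      influenceOp g s b (i b) ((l.drop (b + 1)).prod o) := fun b => by
    rw [prod_drop_ofFn]; rfl
  have after : ∀ b : ℕ, b ≤ d → s.val < b →
      (l.drop b).prod o = EuclideanSpace.single (restrictFrom b σ) 1 := by
    intro b hb
    induction hb using Nat.decreasingInduction with
    | self =>
      intro _
      have h1 : l.drop d = [] := by simp [l]
      have h2 : restrictFrom d σ = fun _ => none := by ext1 c; simp [restrictFrom]
      rw [h1, h2]; rfl
    | of_succ b hb ih =>
      intro hs
      rw [step ⟨b, hb⟩, ih (by omega)]
      exact influenceOp_apply_of_gt g (b := ⟨b, hb⟩) hs (hσ _)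
  have before : ∀ b : ℕ, b ≤ s.val →
      (l.drop b).prod o (restrictBefore b σ) = g σ / √(inflB g s (i s)) := by
    intro b hb
    induction hb using Nat.decreasingInduction with
    | self =>
      rw [step s, after _ s.2 (Nat.lt_succ_self _)]
      exact influenceOp_apply_self g s (hσ s)
    | of_succ b hb ih =>
      rw [step ⟨b, hb.trans s.2⟩, ← ih]
      exact influenceOp_apply_of_lt g (b := ⟨b, hb.trans s.2⟩) hb (hσ _) _
  have h0 : restrictBefore 0 σ = fun _ => none := by ext1 c; simp [restrictBefore]
  simpa [h0] using before 0 (Nat.zero_le _)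

/-- For a homogeneous block-multilinear polynomial of degree `d`
and any block `s ∈ [d]`, the root-influence inequality
`‖p‖_cb ≥ Σ_{i∈[n]} √(Inf_{s,i}[p])` holds. -/
theorem stmt_5 {n d : ℕ} (g : (Fin d → Option (Fin n)) → ℝ)
    (hhom : ∀ σ : Fin d → Option (Fin n), (∃ b, σ b = none) → g σ = 0)
    (s : Fin d) :
    ∑ i : Fin n, Real.sqrt (inflB g s i) ≤ cbNorm g := by
  refine le_trans (le_of_eq ?_) (sum_matrixCoeff_le_cbNorm g (influenceOp g s)
    (norm_influenceOp_le g s) fun _ => none)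
  have hsqrt : ∀ k, √(inflB g s k) =
      ∑ σ : Assignment n d, if σ s = some k then g σ ^ 2 / √(inflB g s k) else 0 := fun k => by
    rw [← Finset.sum_filter, ← Finset.sum_div]
    exact Real.div_sqrt.symm
  rw [Finset.sum_congr rfl fun k _ => hsqrt k, Finset.sum_comm]
  refine Finset.sum_congr rfl fun σ _ => ?_
  by_cases h : ∃ b, σ b = none
  · simp [hhom σ h]
  · have hi : ∀ b, ∃ i, σ b = some i := fun b =>
      Option.ne_none_iff_exists'.1 fun hb => h ⟨b, hb⟩
    choose i hi using hi
    rw [influenceOp_prod_apply g s i hi]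
    simp only [hi, Option.some.injEq, Finset.sum_ite_eq, Finset.mem_univ, if_true]
    ring
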